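/- Let 0 < δ < 1 and let u_0 be δ-Hölder continuous on the closure of D. Then for every T > 0 there exists a constant C > 0 such that the function (x,t) ↦ G_t u_0(x) (with G_0 u_0 = u_0) satisfies |G_t u_0(x) − G_t u_0(y)| ≤ C |x−y|^δ and |G_t u_0(x) − G_s u_0(x)| ≤ C |t−s|^{δ/4} for all x, y ∈ closure(D) and all s, t ∈ [0,T]; that is, it is δ-Hölder continuous in the space variable and δ/4-Hölder continuous in the time variable. -/

import Mathlib

open MeasureTheory Real Set

noncomputable section

/-- The spatial domain `D = (0,π)^d` as a subset of Euclidean space. -/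
def domD (d : ℕ) : Set (EuclideanSpace ℝ (Fin d)) :=
  {x | ∀ i, x i ∈ Set.Ioo (0 : ℝ) π}

/-- One-dimensional normalized cosine functions: `ε_0 = 1/√π`, `ε_j(x) = √(2/π) cos(jx)`. -/
def eps1 (j : ℕ) (x : ℝ) : ℝ :=
  if j = 0 then 1 / Real.sqrt π else Real.sqrt (2 / π) * Real.cos (j * x)

/-- The product functions `ε_k(x) = ∏ i, ε_{k i}(x i)` for a multi-index `k ∈ ℕ^d`. -/
def epsk {d : ℕ} (k : Fin d → ℕ) (x : EuclideanSpace ℝ (Fin d)) : ℝ :=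
  ∏ i, eps1 (k i) (x i)

/-- The eigenvalue `λ_k = ∑ i, k_i²`. -/
def lam {d : ℕ} (k : Fin d → ℕ) : ℝ := ∑ i, (k i : ℝ) ^ 2

/-- The Green's function of `−Δ²+Δ` with homogeneous Neumann boundary conditions on `D`:
`G(x,y,t) = ∑_{k∈ℕ^d} e^{−(λ_k²+λ_k)t} ε_k(x) ε_k(y)`. -/
def green {d : ℕ} (x y : EuclideanSpace ℝ (Fin d)) (t : ℝ) : ℝ :=
  ∑' k : Fin d → ℕ, Real.exp (-(lam k ^ 2 + lam k) * t) * epsk k x * epsk k y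

/-- The action of the convolution semigroup on an initial condition:
`G_t u₀(x) = ∫_D u₀(y) G(x,y,t) dy` for `t > 0`, and `G_0 u₀ = u₀`. -/
def greenSemigroup {d : ℕ} (u₀ : EuclideanSpace ℝ (Fin d) → ℝ) (t : ℝ)
    (x : EuclideanSpace ℝ (Fin d)) : ℝ :=
  if t = 0 then u₀ x else ∫ y in domD d, u₀ y * green x y t

/-- The closed box. -/
def boxK (d : ℕ) : Set (EuclideanSpace ℝ (Fin d)) :=
  {x | ∀ i, x i ∈ Set.Icc (0 : ℝ) π}

lemma closure_domD (d : ℕ) : closure (domD d) = boxK d := by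
  have h1 : domD d = (PiLp.homeomorph 2 (fun _ : Fin d => ℝ)) ⁻¹'
      (Set.univ.pi fun _ => Set.Ioo (0 : ℝ) π) := by
    ext x
    simp [domD, PiLp.homeomorph]
  rw [h1, ← Homeomorph.preimage_closure, closure_pi_set]
  ext x
  simp [boxK, PiLp.homeomorph, closure_Ioo Real.pi_ne_zero.symm, Pi.le_def, forall_and]

lemma isCompact_boxK (d : ℕ) : IsCompact (boxK d) := by
  have h1 : boxK d = (PiLp.homeomorph 2 (fun _ : Fin d => ℝ)) ⁻¹'
      (Set.univ.pi fun _ => Set.Icc (0 : ℝ) π) := by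
    ext x
    simp [boxK, PiLp.homeomorph, Pi.le_def, forall_and]
  rw [h1, Homeomorph.isCompact_preimage]
  exact isCompact_univ_pi fun _ => isCompact_Icc

instance (d : ℕ) : CompactSpace (boxK d) := isCompact_iff_compactSpace.mp (isCompact_boxK d)

/-- One-dimensional folding map. -/
def fold1 (x : ℝ) : ℝ := ‖(x : AddCircle (2 * π))‖

lemma fold1_mem (x : ℝ) : fold1 x ∈ Set.Icc (0 : ℝ) π := by
  refine ⟨norm_nonneg _, ?_⟩
  have h := AddCircle.norm_le_half_period (2 * π) (x := (x : AddCircle (2 * π)))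
    (by positivity)
  rw [abs_of_pos (by positivity)] at h
  unfold fold1
  linarith

lemma fold1_eq {x : ℝ} (hx : x ∈ Set.Icc (0 : ℝ) π) : fold1 x = x := by
  unfold fold1
  have h := (AddCircle.norm_coe_eq_abs_iff (2 * π) (x := x) (by positivity)).2
  rw [h, abs_of_nonneg hx.1]
  rw [abs_of_pos (by positivity : (0 : ℝ) < 2 * π), abs_of_nonneg hx.1]
  linarith [hx.2]

lemma fold1_lip (x y : ℝ) : |fold1 x - fold1 y| ≤ |x - y| := by
  unfold fold1
  refine (abs_norm_sub_norm_le _ _).trans ?_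
  rw [← AddCircle.coe_sub]
  exact QuotientAddGroup.norm_mk_le_norm

lemma cos_fold1 (n : ℕ) (x : ℝ) : Real.cos (n * fold1 x) = Real.cos (n * x) := by
  unfold fold1
  rw [AddCircle.norm_eq]
  set m := round ((2 * π)⁻¹ * x)
  have h : ∀ y : ℝ, Real.cos (n * |y|) = Real.cos (n * y) := by
    intro y
    rcases abs_choice y with h | h <;> rw [h]
    rw [mul_neg, Real.cos_neg]
  rw [h, mul_sub]
  have := Real.cos_sub_int_mul_two_pi (n * x) (n * m)
  rw [← this]
  push_cast
  ring_nf

/-- Folding of the whole space onto the box. -/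
def foldX {d : ℕ} (x : EuclideanSpace ℝ (Fin d)) : EuclideanSpace ℝ (Fin d) :=
  WithLp.toLp 2 fun i => fold1 (x i)

lemma foldX_apply {d : ℕ} (x : EuclideanSpace ℝ (Fin d)) (i : Fin d) :
    foldX x i = fold1 (x i) := rfl

lemma foldX_mem {d : ℕ} (x : EuclideanSpace ℝ (Fin d)) : foldX x ∈ boxK d :=
  fun i => fold1_mem (x i)

lemma foldX_eq {d : ℕ} {x : EuclideanSpace ℝ (Fin d)} (hx : x ∈ boxK d) : foldX x = x := by
  ext i
  exact fold1_eq (hx i)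

lemma foldX_lip {d : ℕ} (x y : EuclideanSpace ℝ (Fin d)) :
    ‖foldX x - foldX y‖ ≤ ‖x - y‖ := by
  rw [EuclideanSpace.norm_eq, EuclideanSpace.norm_eq]
  refine Real.sqrt_le_sqrt (Finset.sum_le_sum fun i _ => ?_)
  have := fold1_lip (x i) (y i)
  simp only [PiLp.sub_apply, foldX_apply, Real.norm_eq_abs]
  gcongr

lemma continuous_foldX {d : ℕ} : Continuous (foldX (d := d)) := by
  refine (LipschitzWith.of_dist_le_mul (K := 1) fun x y => ?_).continuous
  rw [dist_eq_norm, dist_eq_norm]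
  simpa using foldX_lip x y

/-- Folding as a map into the box. -/
def foldK {d : ℕ} (x : EuclideanSpace ℝ (Fin d)) : boxK d := ⟨foldX x, foldX_mem x⟩

lemma continuous_foldK {d : ℕ} : Continuous (foldK (d := d)) :=
  continuous_foldX.subtype_mk _

/-- Unnormalised cosine products. -/
def cosP {d : ℕ} (k : Fin d → ℕ) (x : EuclideanSpace ℝ (Fin d)) : ℝ :=
  ∏ i, Real.cos (k i * x i)

lemma continuous_cosP {d : ℕ} (k : Fin d → ℕ) : Continuous (cosP k) := by
  unfold cosP
  fun_prop

lemma cosP_foldX {d : ℕ} (k : Fin d → ℕ) (x : EuclideanSpace ℝ (Fin d)) :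
    cosP k (foldX x) = cosP k x := by
  unfold cosP
  exact Finset.prod_congr rfl fun i _ => cos_fold1 _ _

/-- Cosine products on the box. -/
def cosK {d : ℕ} (k : Fin d → ℕ) : C(boxK d, ℝ) :=
  ⟨fun x => cosP k x.1, (continuous_cosP k).comp continuous_subtype_val⟩

/-- Coordinate cosine on the box. -/
def cosCoord {d : ℕ} (j : Fin d) : C(boxK d, ℝ) :=
  ⟨fun x => Real.cos (x.1 j), by fun_prop⟩

lemma cosCoord_mul_mem {d : ℕ} (j : Fin d) (k : Fin d → ℕ) :
    cosCoord j * cosK k ∈ Submodule.span ℝ (Set.range (cosK (d := d))) := by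
  have key : cosCoord j * cosK k = (1 / 2 : ℝ) • cosK (Function.update k j (k j + 1)) +
      (1 / 2 : ℝ) • cosK (Function.update k j (if k j = 0 then 1 else k j - 1)) := by
    ext x
    have h : ∀ m : ℕ, cosP (Function.update k j m) x.1 =
        Real.cos (m * x.1 j) * ∏ i ∈ Finset.univ.erase j, Real.cos (k i * x.1 i) := by
      intro m
      unfold cosP
      rw [← Finset.mul_prod_erase _ _ (Finset.mem_univ j)]
      congr 1
      · simp
      · refine Finset.prod_congr rfl fun i hi => ?_
        rw [Function.update_of_ne (Finset.ne_of_mem_erase hi)]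
    have h0 := h (k j)
    rw [Function.update_eq_self] at h0
    simp only [ContinuousMap.mul_apply, ContinuousMap.add_apply, ContinuousMap.smul_apply,
      smul_eq_mul]
    change Real.cos (x.1 j) * cosP k x.1 = 1 / 2 * cosP _ x.1 + 1 / 2 * cosP _ x.1
    rw [h0, h, h]
    by_cases hk : k j = 0
    · simp [hk]
      ring
    · obtain ⟨n, hn⟩ := Nat.exists_eq_succ_of_ne_zero hk
      rw [if_neg hk, hn]
      simp only [Nat.succ_eq_add_one, Nat.add_sub_cancel]
      have e1 : ((n + 1 + 1 : ℕ) : ℝ) * x.1 j = ((n + 1 : ℕ) : ℝ) * x.1 j + x.1 j := by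
        push_cast; ring
      have e2 : ((n : ℕ) : ℝ) * x.1 j = ((n + 1 : ℕ) : ℝ) * x.1 j - x.1 j := by
        push_cast; ring
      rw [e1, e2, Real.cos_add, Real.cos_sub]
      ring
  rw [key]
  refine Submodule.add_mem _ ?_ ?_ <;>
    exact Submodule.smul_mem _ _ (Submodule.subset_span ⟨_, rfl⟩)

lemma dense_cosK (d : ℕ) :
    closure ((Submodule.span ℝ (Set.range (cosK (d := d))) : Submodule ℝ C(boxK d, ℝ)) :
      Set C(boxK d, ℝ)) = Set.univ := by
  set A := Algebra.adjoin ℝ (Set.range (cosCoord (d := d))) with hA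
  have hsep : A.SeparatesPoints := by
    intro x y hxy
    have : ∃ j, x.1 j ≠ y.1 j := by
      by_contra! h
      exact hxy (Subtype.ext (by ext j; exact h j))
    obtain ⟨j, hj⟩ := this
    refine ⟨cosCoord j, ⟨cosCoord j, Algebra.subset_adjoin ⟨j, rfl⟩, rfl⟩, ?_⟩
    intro h
    exact hj (Real.injOn_cos (x.2 j) (y.2 j) h)
  have htop := ContinuousMap.subalgebra_topologicalClosure_eq_top_of_separatesPoints A hsep
  have hsub : (A : Set C(boxK d, ℝ)) ⊆ Submodule.span ℝ (Set.range (cosK (d := d))) := by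
    intro f hf
    have hf' : f ∈ Subalgebra.toSubmodule A := hf
    rw [hA, Algebra.adjoin_eq_span] at hf'
    refine (Submodule.span_le.2 ?_) hf'
    intro g hg
    refine Submonoid.closure_induction_left (motive := fun g _ =>
      g ∈ Submodule.span ℝ (Set.range (cosK (d := d)))) ?_ ?_ hg
    · refine Submodule.subset_span ⟨0, ?_⟩
      ext x
      change cosP 0 x.1 = 1
      simp [cosP]
    · rintro _ ⟨j, rfl⟩ y _ hy
      refine Submodule.span_induction ?_ ?_ ?_ ?_ hy
      · rintro _ ⟨k, rfl⟩
        exact cosCoord_mul_mem j k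
      · simp
      · intro a b _ _ ha hb
        rw [mul_add]
        exact Submodule.add_mem _ ha hb
      · intro c a _ ha
        rw [mul_smul_comm]
        exact Submodule.smul_mem _ _ ha
  have h2 : closure (A : Set C(boxK d, ℝ)) = Set.univ := by
    rw [← Subalgebra.topologicalClosure_coe, htop]
    rfl
  exact Set.eq_univ_of_univ_subset (h2 ▸ closure_mono hsub)

/-- Integration against a kernel as a continuous linear functional. -/
def kerCLM {d : ℕ} {Ω : Type*} [MeasurableSpace Ω] (μ : Measure Ω) (K : Ω → ℝ)
    (hK : Integrable K μ) (φ : Ω → boxK d) (hφ : Measurable φ) : C(boxK d, ℝ) →L[ℝ] ℝ :=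
  have hint : ∀ f : C(boxK d, ℝ), Integrable (fun w => f (φ w) * K w) μ := fun f =>
    hK.bdd_mul (c := ‖f‖) ((f.continuous.measurable.comp hφ).aestronglyMeasurable)
      (Filter.Eventually.of_forall fun w => f.norm_coe_le_norm (φ w))
  LinearMap.mkContinuous
    { toFun := fun f => ∫ w, f (φ w) * K w ∂μ
      map_add' := fun f g => by
        rw [← integral_add (hint f) (hint g)]
        simp only [ContinuousMap.add_apply, add_mul]
      map_smul' := fun c f => by
        simp only [ContinuousMap.smul_apply, smul_eq_mul, mul_assoc, RingHom.id_apply]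
        rw [integral_const_mul] } (∫ w, ‖K w‖ ∂μ) (fun f => by
        refine (norm_integral_le_integral_norm _).trans ?_
        rw [mul_comm, ← integral_const_mul]
        refine integral_mono (hint f).norm (hK.norm.const_mul _) fun w => ?_
        simp only [norm_mul]
        exact mul_le_mul_of_nonneg_right (f.norm_coe_le_norm _) (norm_nonneg _))

lemma kerCLM_apply {d : ℕ} {Ω : Type*} [MeasurableSpace Ω] (μ : Measure Ω) (K : Ω → ℝ)
    (hK : Integrable K μ) (φ : Ω → boxK d) (hφ : Measurable φ) (f : C(boxK d, ℝ)) :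
    kerCLM μ K hK φ hφ f = ∫ w, f (φ w) * K w ∂μ := rfl

lemma clm_eq_of_cosK {d : ℕ} (A B : C(boxK d, ℝ) →L[ℝ] ℝ)
    (h : ∀ k, A (cosK k) = B (cosK k)) (f : C(boxK d, ℝ)) : A f = B f := by
  have h1 : Set.EqOn A B (Set.range (cosK (d := d))) := by
    rintro _ ⟨k, rfl⟩
    exact h k
  have h2 := ContinuousLinearMap.eqOn_closure_span h1
  rw [dense_cosK] at h2
  exact h2 (Set.mem_univ f)

lemma integral_cos_int (m : ℤ) (hm : m ≠ 0) : ∫ x in (0 : ℝ)..π, Real.cos (m * x) = 0 := by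
  have hm' : (m : ℝ) ≠ 0 := by exact_mod_cast hm
  rw [intervalIntegral.integral_comp_mul_left (fun x => Real.cos x) hm']
  simp [integral_cos, Real.sin_int_mul_pi]

lemma eps1_ortho (j k : ℕ) :
    ∫ x in Set.Ioo (0 : ℝ) π, eps1 j x * eps1 k x = if j = k then 1 else 0 := by
  rw [← integral_Ioc_eq_integral_Ioo, ← intervalIntegral.integral_of_le Real.pi_pos.le]
  have hpi := Real.pi_pos
  have hcc : ∀ a b : ℕ, ∫ x in (0 : ℝ)..π, Real.cos (a * x) * Real.cos (b * x) =
      ((∫ x in (0 : ℝ)..π, Real.cos (((a : ℤ) - b : ℤ) * x)) +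
       ∫ x in (0 : ℝ)..π, Real.cos (((a : ℤ) + b : ℤ) * x)) / 2 := by
    intro a b
    rw [← intervalIntegral.integral_add (by apply Continuous.intervalIntegrable; fun_prop)
      (by apply Continuous.intervalIntegrable; fun_prop), ← intervalIntegral.integral_div]
    congr 1
    ext x
    push_cast
    rw [sub_mul, add_mul, Real.cos_add, Real.cos_sub]
    ring
  obtain ⟨c, hc⟩ : ∃ c : ℕ → ℝ, ∀ j, (c j) ^ 2 = (if j = 0 then 1 / π else 2 / π) ∧
      ∀ x, eps1 j x = c j * Real.cos (j * x) := by
    refine ⟨fun j => if j = 0 then 1 / Real.sqrt π else Real.sqrt (2 / π), fun j => ?_⟩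
    by_cases hj : j = 0
    · simp [hj, eps1, Real.sq_sqrt hpi.le]
    · simp [hj, eps1, div_pow, Real.sq_sqrt hpi.le]
  have h1 : ∫ x in (0 : ℝ)..π, eps1 j x * eps1 k x =
      c j * c k * ∫ x in (0 : ℝ)..π, Real.cos (j * x) * Real.cos (k * x) := by
    rw [← intervalIntegral.integral_const_mul]
    congr 1
    ext x
    rw [(hc j).2, (hc k).2]
    ring
  rw [h1, hcc]
  by_cases hjk : j = k
  · subst hjk
    rw [if_pos rfl, ← sq, (hc j).1]
    by_cases hj : j = 0
    · subst hj
      simp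
    · rw [integral_cos_int ((j : ℤ) + j) (by omega)]
      simp [hj]
  · rw [if_neg hjk, integral_cos_int ((j : ℤ) - k) (by omega),
      integral_cos_int ((j : ℤ) + k) (by omega)]
    simp

lemma integral_domD_prod {d : ℕ} (g : Fin d → ℝ → ℝ) :
    ∫ y in domD d, ∏ i, g i (y i) = ∏ i, ∫ x in Set.Ioo (0 : ℝ) π, g i x := by
  have h1 : domD d = (WithLp.ofLp) ⁻¹' (Set.univ.pi fun _ => Set.Ioo (0 : ℝ) π) := by
    ext x
    simp [domD]
  have h2 := (PiLp.volume_preserving_ofLp (Fin d)).setIntegral_preimage_emb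
    (MeasurableEquiv.toLp 2 (Fin d → ℝ)).symm.measurableEmbedding
    (fun y : Fin d → ℝ => ∏ i, g i (y i)) (Set.univ.pi fun _ => Set.Ioo (0 : ℝ) π)
  rw [h1, h2, volume_pi, Measure.restrict_pi_pi, integral_fintype_prod_eq_prod]

lemma epsk_ortho {d : ℕ} (k l : Fin d → ℕ) :
    ∫ y in domD d, epsk k y * epsk l y = if k = l then 1 else 0 := by
  unfold epsk
  simp_rw [← Finset.prod_mul_distrib]
  rw [integral_domD_prod (fun i x => eps1 (k i) x * eps1 (l i) x)]
  simp_rw [eps1_ortho]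
  by_cases h : k = l
  · simp [h]
  · rw [if_neg h]
    obtain ⟨i, hi⟩ := Function.ne_iff.1 h
    exact Finset.prod_eq_zero (Finset.mem_univ i) (by rw [if_neg hi])

lemma continuous_epsk {d : ℕ} (k : Fin d → ℕ) : Continuous (epsk k) := by
  unfold epsk
  refine continuous_finsetProd _ fun i _ => ?_
  unfold eps1
  split_ifs <;> fun_prop

lemma abs_eps1_le (j : ℕ) (x : ℝ) : |eps1 j x| ≤ 1 := by
  have hpi := Real.pi_gt_three
  unfold eps1
  split_ifs
  · rw [abs_of_nonneg (by positivity), div_le_one (by positivity)]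
    exact Real.one_le_sqrt.2 (by linarith)
  · rw [abs_mul, abs_of_nonneg (Real.sqrt_nonneg _)]
    refine mul_le_one₀ ?_ (abs_nonneg _) (Real.abs_cos_le_one _)
    refine Real.sqrt_le_one.2 ?_
    rw [div_le_one (by positivity)]
    linarith

lemma abs_epsk_le {d : ℕ} (k : Fin d → ℕ) (x : EuclideanSpace ℝ (Fin d)) : |epsk k x| ≤ 1 := by
  unfold epsk
  rw [Finset.abs_prod]
  exact Finset.prod_le_one (fun _ _ => abs_nonneg _) fun i _ => abs_eps1_le _ _

/-- Eigenvalues of the generator. -/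
def muk {d : ℕ} (k : Fin d → ℕ) : ℝ := lam k ^ 2 + lam k

lemma summable_exp {d : ℕ} {t : ℝ} (ht : 0 < t) :
    Summable fun k : Fin d → ℕ => Real.exp (-(lam k ^ 2 + lam k) * t) := by
  have hg : Summable fun n : ℕ => Real.exp (-t) ^ n :=
    summable_geometric_of_lt_one (Real.exp_pos _).le (Real.exp_lt_one_iff.2 (by linarith))
  have hp : Summable fun k : Fin d → ℕ => ∏ i, Real.exp (-t) ^ (k i) := by
    refine summable_of_sum_le (c := ∏ _i : Fin d, ∑' n : ℕ, Real.exp (-t) ^ n)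
      (fun k => by positivity) fun s => ?_
    calc ∑ k ∈ s, ∏ i, Real.exp (-t) ^ (k i)
        ≤ ∑ k ∈ Fintype.piFinset (fun i : Fin d => s.image fun k => k i),
            ∏ i, Real.exp (-t) ^ (k i) := by
          refine Finset.sum_le_sum_of_subset_of_nonneg ?_ fun _ _ _ => by positivity
          intro k hk
          rw [Fintype.mem_piFinset]
          intro i
          exact Finset.mem_image_of_mem _ hk
      _ = ∏ i : Fin d, ∑ n ∈ s.image (fun k => k i), Real.exp (-t) ^ n := by
          rw [Finset.prod_univ_sum]
      _ ≤ _ := by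
          refine Finset.prod_le_prod (fun _ _ => by positivity) fun i _ => ?_
          exact hg.sum_le_tsum _ fun _ _ => by positivity
  refine hp.of_nonneg_of_le (fun _ => (Real.exp_pos _).le) fun k => ?_
  simp_rw [← Real.exp_nat_mul]
  rw [← Real.exp_sum]
  refine Real.exp_le_exp.2 ?_
  rw [← Finset.sum_mul]
  have h1 : ∑ i, (k i : ℝ) ≤ lam k := by
    unfold lam
    refine Finset.sum_le_sum fun i _ => ?_
    have : k i ≤ k i ^ 2 := Nat.le_self_pow (by norm_num) _
    exact_mod_cast this
  nlinarith [sq_nonneg (lam k)]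

lemma domD_volume_lt_top (d : ℕ) : volume (domD d) < ⊤ := by
  refine lt_of_le_of_lt (measure_mono subset_closure) ?_
  rw [closure_domD]
  exact (isCompact_boxK d).measure_lt_top

instance (d : ℕ) : IsFiniteMeasure (volume.restrict (domD d)) :=
  ⟨by rw [Measure.restrict_apply_univ]; exact domD_volume_lt_top d⟩

lemma measurableSet_domD (d : ℕ) : MeasurableSet (domD d) := by
  have h : domD d = ⋂ i, {x | x i ∈ Set.Ioo (0 : ℝ) π} := by
    ext x
    simp [domD]
  rw [h]
  refine MeasurableSet.iInter fun i => ?_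
  exact measurableSet_Ioo.preimage (by fun_prop)

lemma integrable_epsk {d : ℕ} (k : Fin d → ℕ) : Integrable (epsk k) (volume.restrict (domD d)) :=
  Integrable.of_bound (continuous_epsk k).aestronglyMeasurable 1
    (Filter.Eventually.of_forall fun x => abs_epsk_le k x)

lemma swap_sum {d : ℕ} (a : (Fin d → ℕ) → ℝ) (ha : Summable fun k => |a k|)
    (v : EuclideanSpace ℝ (Fin d) → ℝ) (hv : Integrable v (volume.restrict (domD d))) :
    ∫ y in domD d, v y * ∑' k, a k * epsk k y =
      ∑' k, a k * ∫ y in domD d, v y * epsk k y := by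
  have hint : ∀ k, Integrable (fun y => v y * epsk k y) (volume.restrict (domD d)) := fun k =>
    hv.mul_bdd (c := 1) (continuous_epsk k).aestronglyMeasurable
      (Filter.Eventually.of_forall fun x => abs_epsk_le k x)
  have h := hasSum_integral_of_summable_integral_norm (μ := volume.restrict (domD d))
    (F := fun k y => a k * (v y * epsk k y)) (fun k => (hint k).const_mul _) ?_
  · rw [← integral_congr_ae (Filter.Eventually.of_forall fun y => ?_), ← h.tsum_eq]
    · simp_rw [integral_const_mul]
    · rw [← tsum_mul_left]
      congr 1
      ext k
      ring
  · refine (ha.mul_right (∫ y in domD d, ‖v y‖)).of_nonneg_of_le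
      (fun k => integral_nonneg fun y => norm_nonneg _) fun k => ?_
    rw [← integral_const_mul]
    refine integral_mono ((hint k).const_mul _).norm (hv.norm.const_mul _) fun y => ?_
    simp only [norm_mul, Real.norm_eq_abs]
    refine mul_le_mul_of_nonneg_left ?_ (abs_nonneg _)
    exact mul_le_of_le_one_right (abs_nonneg _) (abs_epsk_le k y)

lemma summable_coef {d : ℕ} {t : ℝ} (ht : 0 < t) (x : EuclideanSpace ℝ (Fin d)) :
    Summable fun k : Fin d → ℕ => |Real.exp (-(lam k ^ 2 + lam k) * t) * epsk k x| := by
  refine (summable_exp ht).of_nonneg_of_le (fun _ => abs_nonneg _) fun k => ?_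
  rw [abs_mul, Real.abs_exp]
  exact mul_le_of_le_one_right (Real.exp_pos _).le (abs_epsk_le k x)

/-- Cosine coefficients. -/
def coefK {d : ℕ} (v : EuclideanSpace ℝ (Fin d) → ℝ) (k : Fin d → ℕ) : ℝ :=
  ∫ y in domD d, v y * epsk k y

lemma greenSemigroup_eq_tsum {d : ℕ} {t : ℝ} (ht : 0 < t)
    (v : EuclideanSpace ℝ (Fin d) → ℝ) (hv : Integrable v (volume.restrict (domD d)))
    (x : EuclideanSpace ℝ (Fin d)) :
    greenSemigroup v t x =
      ∑' k, Real.exp (-(lam k ^ 2 + lam k) * t) * epsk k x * coefK v k := by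
  unfold greenSemigroup green
  rw [if_neg ht.ne']
  exact swap_sum _ (summable_coef ht x) v hv

lemma abs_coefK_le {d : ℕ} (v : EuclideanSpace ℝ (Fin d) → ℝ)
    (hv : Integrable v (volume.restrict (domD d))) (k : Fin d → ℕ) :
    |coefK v k| ≤ ∫ y in domD d, ‖v y‖ := by
  unfold coefK
  rw [← Real.norm_eq_abs]
  refine (norm_integral_le_integral_norm _).trans ?_
  refine integral_mono_of_nonneg (Filter.Eventually.of_forall fun y => norm_nonneg _) hv.norm
    (Filter.Eventually.of_forall fun y => ?_)
  simp only [norm_mul]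
  exact mul_le_of_le_one_right (norm_nonneg _) (abs_epsk_le k y)

lemma coefK_tsum {d : ℕ} (a : (Fin d → ℕ) → ℝ) (ha : Summable fun k => |a k|)
    (l : Fin d → ℕ) : coefK (fun y => ∑' k, a k * epsk k y) l = a l := by
  unfold coefK
  simp_rw [mul_comm _ (epsk l _)]
  rw [swap_sum a ha _ (integrable_epsk l)]
  simp_rw [epsk_ortho]
  rw [tsum_eq_single l]
  · simp
  · intro k hk
    rw [if_neg hk.symm, mul_zero]

lemma summable_coef_mul {d : ℕ} {t : ℝ} (ht : 0 < t)
    (v : EuclideanSpace ℝ (Fin d) → ℝ) (hv : Integrable v (volume.restrict (domD d))) :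
    Summable fun k : Fin d → ℕ => |Real.exp (-(lam k ^ 2 + lam k) * t) * coefK v k| := by
  refine ((summable_exp ht).mul_right (∫ y in domD d, ‖v y‖)).of_nonneg_of_le
    (fun _ => abs_nonneg _) fun k => ?_
  rw [abs_mul, Real.abs_exp]
  exact mul_le_mul_of_nonneg_left (abs_coefK_le v hv k) (Real.exp_pos _).le

lemma continuous_greenSemigroup {d : ℕ} {t : ℝ} (ht : 0 < t)
    (v : EuclideanSpace ℝ (Fin d) → ℝ) (hv : Integrable v (volume.restrict (domD d))) :
    Continuous (greenSemigroup v t) := by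
  have h : greenSemigroup v t = fun x =>
      ∑' k, Real.exp (-(lam k ^ 2 + lam k) * t) * coefK v k * epsk k x := by
    ext x
    rw [greenSemigroup_eq_tsum ht v hv]
    congr 1
    ext k
    ring
  rw [h]
  refine continuous_tsum (fun k => continuous_const.mul (continuous_epsk k))
    (summable_coef_mul ht v hv) fun k x => ?_
  rw [norm_mul]
  exact mul_le_of_le_one_right (norm_nonneg _) (abs_epsk_le k x)

lemma integrable_greenSemigroup {d : ℕ} {t : ℝ} (ht : 0 < t)
    (v : EuclideanSpace ℝ (Fin d) → ℝ) (hv : Integrable v (volume.restrict (domD d))) :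
    Integrable (greenSemigroup v t) (volume.restrict (domD d)) := by
  have h := ((continuous_greenSemigroup ht v hv).continuousOn.integrableOn_compact
    (μ := volume) (isCompact_boxK d))
  exact h.mono_set (by rw [← closure_domD]; exact subset_closure)

lemma greenSemigroup_add {d : ℕ} {s t : ℝ} (hs : 0 < s) (ht : 0 < t)
    (v : EuclideanSpace ℝ (Fin d) → ℝ) (hv : Integrable v (volume.restrict (domD d)))
    (x : EuclideanSpace ℝ (Fin d)) :
    greenSemigroup (greenSemigroup v s) t x = greenSemigroup v (t + s) x := by
  rw [greenSemigroup_eq_tsum ht _ (integrable_greenSemigroup hs v hv),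
    greenSemigroup_eq_tsum (add_pos ht hs) v hv]
  congr 1
  ext k
  have h : greenSemigroup v s = fun x =>
      ∑' k, Real.exp (-(lam k ^ 2 + lam k) * s) * coefK v k * epsk k x := by
    ext x
    rw [greenSemigroup_eq_tsum hs v hv]
    congr 1
    ext k
    ring
  rw [h, coefK_tsum _ (summable_coef_mul hs v hv), mul_add, Real.exp_add]
  ring

lemma greenSemigroup_epsk {d : ℕ} {t : ℝ} (ht : 0 < t) (l : Fin d → ℕ)
    (x : EuclideanSpace ℝ (Fin d)) :
    greenSemigroup (epsk l) t x = Real.exp (-(lam l ^ 2 + lam l) * t) * epsk l x := by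
  rw [greenSemigroup_eq_tsum ht _ (integrable_epsk l), tsum_eq_single l]
  · unfold coefK
    rw [epsk_ortho, if_pos rfl, mul_one]
  · intro k hk
    unfold coefK
    rw [epsk_ortho, if_neg hk.symm, mul_zero]

lemma greenSemigroup_cosP {d : ℕ} {t : ℝ} (ht : 0 < t) (l : Fin d → ℕ)
    (x : EuclideanSpace ℝ (Fin d)) :
    greenSemigroup (cosP l) t x = Real.exp (-(lam l ^ 2 + lam l) * t) * cosP l x := by
  obtain ⟨c, hc⟩ : ∃ c : ℝ, cosP l = fun x => c * epsk l x := by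
    have hpi := Real.pi_pos
    refine ⟨∏ i, (if l i = 0 then Real.sqrt π else (Real.sqrt (2 / π))⁻¹), ?_⟩
    ext x
    unfold cosP epsk
    rw [← Finset.prod_mul_distrib]
    refine Finset.prod_congr rfl fun i _ => ?_
    unfold eps1
    split_ifs with h
    · simp [h, (Real.sqrt_pos.2 hpi).ne']
    · rw [← mul_assoc, inv_mul_cancel₀ (Real.sqrt_pos.2 (by positivity)).ne', one_mul]
  have h2 : greenSemigroup (cosP l) t x = c * greenSemigroup (epsk l) t x := by
    unfold greenSemigroup
    rw [if_neg ht.ne', if_neg ht.ne', ← integral_const_mul, hc]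
    simp_rw [mul_assoc]
  rw [h2, greenSemigroup_epsk ht, hc]
  ring

lemma integrable_green {d : ℕ} {t : ℝ} (ht : 0 < t) (x : EuclideanSpace ℝ (Fin d)) :
    Integrable (fun y => green x y t) (volume.restrict (domD d)) := by
  have hc : Continuous fun y => green x y t := by
    unfold green
    refine continuous_tsum (fun k => continuous_const.mul (continuous_epsk k))
      (summable_coef ht x) fun k y => ?_
    rw [norm_mul]
    exact mul_le_of_le_one_right (norm_nonneg _) (abs_epsk_le k y)
  have h := (hc.continuousOn.integrableOn_compact (μ := volume) (isCompact_boxK d))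
  exact h.mono_set (by rw [← closure_domD]; exact subset_closure)

/-- Normalisation of the complex Gaussian. -/
def prefG (s : ℝ) : ℂ := (((π : ℂ) / -(-(1 + s * Complex.I) / 4)) ^ (1 / 2 : ℂ))⁻¹

/-- Complex Gaussian density. -/
def gamG (s z : ℝ) : ℂ := prefG s * Complex.exp (-(1 + s * Complex.I) / 4 * (z : ℂ) ^ 2)

lemma one_add_ne (s : ℝ) : (1 + s * Complex.I : ℂ) ≠ 0 := by
  intro h
  have := congrArg Complex.re h
  simp at this

lemma base_slit (s : ℝ) : ((π : ℂ) / -(-(1 + s * Complex.I) / 4)) ∈ Complex.slitPlane := by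
  left
  have h : ((π : ℂ) / -(-(1 + s * Complex.I) / 4)) =
      ((4 * π / (1 + s ^ 2) : ℝ) : ℂ) * (1 - s * Complex.I) := by
    have h1 := one_add_ne s
    have h2 : ((1 : ℂ) + s ^ 2) ≠ 0 := by
      have : (1 + s ^ 2 : ℝ) ≠ 0 := by positivity
      exact_mod_cast this
    push_cast
    field_simp
    linear_combination ((s : ℂ) ^ 2) * Complex.I_sq
  rw [h, Complex.re_ofReal_mul]
  simp
  positivity

lemma pow_ne (s : ℝ) : ((π : ℂ) / -(-(1 + s * Complex.I) / 4)) ^ (1 / 2 : ℂ) ≠ 0 := by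
  rw [Complex.cpow_ne_zero_iff]
  left
  exact Complex.slitPlane_ne_zero (base_slit s)

lemma continuous_prefG : Continuous prefG := by
  unfold prefG
  refine Continuous.inv₀ ?_ pow_ne
  refine Continuous.cpow ?_ continuous_const base_slit
  refine Continuous.div continuous_const (by fun_prop) fun s h => ?_
  have := one_add_ne s
  apply this
  linear_combination 4 * h

lemma norm_prefG_le (s : ℝ) : ‖prefG s‖ ≤ 1 + s ^ 2 := by
  have h : prefG s ^ 2 = (1 + s * Complex.I) / (4 * π) := by
    unfold prefG
    rw [inv_pow, ← Complex.cpow_nat_mul]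
    norm_num
    have : (π : ℂ) ≠ 0 := by exact_mod_cast Real.pi_ne_zero
    have := one_add_ne s
    field_simp
    ring
  have h2 : ‖prefG s‖ ^ 2 ≤ (1 + s ^ 2) ^ 2 := by
    rw [← norm_pow, h, norm_div]
    have h3 : ‖(1 + s * Complex.I : ℂ)‖ ≤ 1 + |s| := by
      refine (norm_add_le _ _).trans ?_
      simp
    have h4 : (2 : ℝ) ≤ ‖(4 * π : ℂ)‖ := by
      rw [norm_mul, Complex.norm_real, Real.norm_of_nonneg Real.pi_pos.le]
      simp
      linarith [Real.pi_gt_three]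
    rw [div_le_iff₀ (by linarith)]
    refine h3.trans ?_
    have h5 : 1 + |s| ≤ (1 + s ^ 2) ^ 2 * 2 := by
      nlinarith [sq_abs s, sq_nonneg (|s| - 1), sq_nonneg (s ^ 2)]
    exact h5.trans (mul_le_mul_of_nonneg_left h4 (by positivity))
  exact le_of_sq_le_sq h2 (by positivity)

lemma re_b_neg (s : ℝ) : (-(1 + s * Complex.I) / 4 : ℂ).re < 0 := by
  have : (-(1 + s * Complex.I) / 4 : ℂ) = ((-1 / 4 : ℝ) : ℂ) + ((-s / 4 : ℝ) : ℂ) * Complex.I := by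
    push_cast; ring
  rw [this]
  simp
  norm_num

lemma norm_gamG (s z : ℝ) : ‖gamG s z‖ ≤ (1 + s ^ 2) * Real.exp (-z ^ 2 / 4) := by
  unfold gamG
  rw [norm_mul, Complex.norm_exp]
  have : (-(1 + s * Complex.I) / 4 * (z : ℂ) ^ 2) =
      ((-z ^ 2 / 4 : ℝ) : ℂ) + ((-s * z ^ 2 / 4 : ℝ) : ℂ) * Complex.I := by
    push_cast; ring
  rw [this]
  simp only [Complex.add_re, Complex.ofReal_re, Complex.re_ofReal_mul, Complex.I_re, mul_zero,
    add_zero]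
  exact mul_le_mul_of_nonneg_right (norm_prefG_le s) (Real.exp_pos _).le

lemma gauss1 (s k x r : ℝ) :
    ∫ z : ℝ, gamG s z * ((Real.cos (k * (x - r * z)) : ℝ) : ℂ) =
      Complex.exp (-(k ^ 2 * r ^ 2) / (1 + s * Complex.I)) * ((Real.cos (k * x) : ℝ) : ℂ) := by
  have hb := re_b_neg s
  have hne := one_add_ne s
  have hi : ∀ c e : ℂ, Integrable fun z : ℝ =>
      Complex.exp (-(1 + s * Complex.I) / 4 * (z : ℂ) ^ 2 + c * z + e) := fun c e =>
    integrable_cexp_quadratic' hb c e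
  have h1 : ∀ z : ℝ, gamG s z * ((Real.cos (k * (x - r * z)) : ℝ) : ℂ) =
      prefG s / 2 * (Complex.exp (-(1 + s * Complex.I) / 4 * (z : ℂ) ^ 2 +
        (-(k * r * Complex.I)) * z + k * x * Complex.I) +
        Complex.exp (-(1 + s * Complex.I) / 4 * (z : ℂ) ^ 2 +
        (k * r * Complex.I) * z + -(k * x * Complex.I))) := by
    intro z
    unfold gamG
    rw [Complex.ofReal_cos, Complex.cos]
    simp only [Complex.exp_add, Complex.exp_neg]
    have e1 : Complex.exp (((k * (x - r * z) : ℝ) : ℂ) * Complex.I) =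
        Complex.exp (-(k * r * Complex.I) * z) * Complex.exp (k * x * Complex.I) := by
      rw [← Complex.exp_add]; push_cast; ring_nf
    have e2 : Complex.exp (-((k * (x - r * z) : ℝ) : ℂ) * Complex.I) =
        Complex.exp ((k * r * Complex.I) * z) * (Complex.exp (k * x * Complex.I))⁻¹ := by
      rw [← Complex.exp_neg, ← Complex.exp_add]; push_cast; ring_nf
    rw [e1, e2]
    ring
  simp_rw [h1]
  rw [integral_const_mul, integral_add (hi _ _) (hi _ _), integral_cexp_quadratic hb,
    integral_cexp_quadratic hb]
  have e3 : ∀ c e : ℂ, c ^ 2 = -(k ^ 2 * r ^ 2) →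
      e - c ^ 2 / (4 * (-(1 + s * Complex.I) / 4)) =
        -(k ^ 2 * r ^ 2) / (1 + s * Complex.I) + e := by
    intro c e hc
    rw [hc]
    field_simp
    ring
  rw [e3 _ _ (by linear_combination (k : ℂ) ^ 2 * r ^ 2 * Complex.I_sq),
    e3 _ _ (by linear_combination (k : ℂ) ^ 2 * r ^ 2 * Complex.I_sq), Complex.exp_add,
    Complex.exp_add, Complex.ofReal_cos, Complex.cos]
  unfold prefG
  have := pow_ne s
  push_cast
  have e4 : (-(k * x) * Complex.I : ℂ) = -(k * x * Complex.I) := by ring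
  rw [e4]
  generalize ((π : ℂ) / -(-(1 + s * Complex.I) / 4)) ^ (1 / 2 : ℂ) = P at *
  field_simp

/-- Normalisation of the time weight. -/
def prefW : ℂ := (((π : ℂ) / -(-1 / 4)) ^ (1 / 2 : ℂ))⁻¹

/-- The time weight. -/
def wW (t s : ℝ) : ℂ := prefW * Complex.exp ((t : ℂ) / 4 - (s + Complex.I) ^ 2 / 4
  - (1 - s * Complex.I) * (Real.sqrt t : ℂ) / 2)

lemma norm_wW (t s : ℝ) : ‖wW t s‖ ≤ ‖prefW‖ * Real.exp (t / 4 + 1 / 4 - s ^ 2 / 4) := by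
  unfold wW
  rw [norm_mul, Complex.norm_exp]
  have : ((t : ℂ) / 4 - (s + Complex.I) ^ 2 / 4 - (1 - s * Complex.I) * (Real.sqrt t : ℂ) / 2) =
      ((t / 4 + 1 / 4 - s ^ 2 / 4 - Real.sqrt t / 2 : ℝ) : ℂ) +
      ((-s / 2 + s * Real.sqrt t / 2 : ℝ) : ℂ) * Complex.I := by
    push_cast
    linear_combination (-1 / 4 : ℂ) * Complex.I_sq
  rw [this]
  simp only [Complex.add_re, Complex.ofReal_re, Complex.re_ofReal_mul, Complex.I_re, mul_zero,
    add_zero]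
  refine mul_le_mul_of_nonneg_left (Real.exp_le_exp.2 ?_) (norm_nonneg _)
  linarith [Real.sqrt_nonneg t]

lemma integral_wW (t l : ℝ) (ht : 0 ≤ t) :
    ∫ s : ℝ, wW t s * Complex.exp (-(1 - s * Complex.I) * (l * Real.sqrt t)) =
      ((Real.exp (-(l ^ 2 + l) * t) : ℝ) : ℂ) := by
  have h1 : ∀ s : ℝ, wW t s * Complex.exp (-(1 - s * Complex.I) * (l * Real.sqrt t)) =
      prefW * Complex.exp ((-1 / 4 : ℂ) * (s : ℂ) ^ 2 +
        (Complex.I * (Real.sqrt t * (l + 1 / 2) - 1 / 2)) * s +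
        (t / 4 + 1 / 4 - Real.sqrt t * (l + 1 / 2))) := by
    intro s
    unfold wW
    rw [mul_assoc, ← Complex.exp_add]
    congr 2
    linear_combination (-1 / 4 : ℂ) * Complex.I_sq
  simp_rw [h1]
  rw [integral_const_mul, integral_cexp_quadratic (by norm_num)]
  unfold prefW
  rw [← mul_assoc, inv_mul_cancel₀, one_mul, Complex.ofReal_exp]
  · congr 1
    have hs : (Real.sqrt t : ℂ) ^ 2 = t := by
      exact_mod_cast Real.sq_sqrt ht
    push_cast
    rw [mul_pow, Complex.I_sq]
    linear_combination (-(l + 1 / 2 : ℂ) ^ 2) * hs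
  · rw [Complex.cpow_ne_zero_iff]
    left
    have : (π : ℂ) ≠ 0 := by exact_mod_cast Real.pi_ne_zero
    simp [this]

/-- The complex kernel. -/
def kerC {d : ℕ} (t : ℝ) (p : ℝ × (Fin d → ℝ)) : ℂ := wW t p.1 * ∏ i, gamG p.1 (p.2 i)

lemma continuous_kerC {d : ℕ} (t : ℝ) : Continuous (kerC (d := d) t) := by
  unfold kerC wW gamG
  have := continuous_prefG
  fun_prop

/-- The Gaussian dominating function. -/
def domF {d : ℕ} (p : ℝ × (Fin d → ℝ)) : ℝ :=
  Real.exp (-(1 / 8) * p.1 ^ 2) * ∏ i, Real.exp (-(1 / 8) * p.2 i ^ 2)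

lemma integrable_domF (d : ℕ) : Integrable (domF (d := d)) := by
  have h := integrable_exp_neg_mul_sq (b := 1 / 8) (by norm_num)
  exact h.mul_prod (Integrable.fintype_prod (μ := fun _ => volume) fun _ => h)

/-- The unscaled shift. -/
def shX {d : ℕ} (p : ℝ × (Fin d → ℝ)) : EuclideanSpace ℝ (Fin d) :=
  Real.sqrt (1 + p.1 ^ 2) • WithLp.toLp 2 p.2

lemma norm_toLp_le {d : ℕ} (z : Fin d → ℝ) :
    ‖(WithLp.toLp 2 z : EuclideanSpace ℝ (Fin d))‖ ≤ ∑ i, |z i| := by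
  rw [EuclideanSpace.norm_eq]
  refine Real.sqrt_le_iff.2 ⟨by positivity, ?_⟩
  simp only [Real.norm_eq_abs]
  exact Finset.sum_sq_le_sq_sum_of_nonneg fun i _ => abs_nonneg _

lemma kerC_bound (d : ℕ) (T : ℝ) : ∃ M : ℝ, 0 ≤ M ∧ ∀ t ≤ T, ∀ p : ℝ × (Fin d → ℝ),
    ‖kerC t p‖ * (1 + ‖shX p‖) ≤ M * domF p := by
  refine ⟨‖prefW‖ * Real.exp (T / 4 + 1 / 4) * (8 ^ (d + 1) * (d + 1).factorial *
    Real.exp (1 / 8)) * Real.exp 2 ^ d, by positivity, fun t ht p => ?_⟩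
  obtain ⟨s, z⟩ := p
  have a1 : ‖wW t s‖ ≤ ‖prefW‖ * Real.exp (T / 4 + 1 / 4) * Real.exp (-s ^ 2 / 4) := by
    refine (norm_wW t s).trans ?_
    rw [mul_assoc, ← Real.exp_add]
    refine mul_le_mul_of_nonneg_left (Real.exp_le_exp.2 ?_) (norm_nonneg _)
    linarith
  have a2 : ‖∏ i, gamG s (z i)‖ ≤ (1 + s ^ 2) ^ d * ∏ i, Real.exp (-z i ^ 2 / 4) := by
    rw [norm_prod]
    refine (Finset.prod_le_prod (fun _ _ => norm_nonneg _) fun i _ => norm_gamG s (z i)).trans ?_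
    rw [Finset.prod_mul_distrib]
    simp
  have a3 : 1 + ‖shX (s, z)‖ ≤ (1 + s ^ 2) * ∏ i, Real.exp (2 + z i ^ 2 / 8) := by
    have b1 : ‖shX (s, z)‖ ≤ (1 + s ^ 2) * ∑ i, |z i| := by
      unfold shX
      rw [norm_smul, Real.norm_of_nonneg (Real.sqrt_nonneg _)]
      refine mul_le_mul ?_ (norm_toLp_le z) (norm_nonneg _) (by positivity)
      refine Real.sqrt_le_iff.2 ⟨by positivity, ?_⟩
      simp only
      nlinarith [sq_nonneg s, sq_nonneg (s ^ 2)]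
    have b2 : ∑ i, |z i| + 1 ≤ ∏ i, Real.exp (2 + z i ^ 2 / 8) := by
      refine (Real.add_one_le_exp _).trans ?_
      rw [← Real.exp_sum]
      refine Real.exp_le_exp.2 (Finset.sum_le_sum fun i _ => ?_)
      nlinarith [sq_abs (z i), sq_nonneg (|z i| - 4)]
    have b3 := mul_le_mul_of_nonneg_left b2 (by positivity : 0 ≤ 1 + s ^ 2)
    nlinarith [sq_nonneg s]
  have a4 : (1 + s ^ 2) ^ (d + 1) ≤ (8 ^ (d + 1) * (d + 1).factorial *
      Real.exp (1 / 8)) * Real.exp (s ^ 2 / 8) := by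
    have := Real.pow_div_factorial_le_exp ((1 + s ^ 2) / 8) (by positivity) (d + 1)
    rw [div_le_iff₀ (by positivity), div_pow, div_le_iff₀ (by positivity), add_div,
      Real.exp_add] at this
    linarith
  calc ‖kerC t (s, z)‖ * (1 + ‖shX (s, z)‖)
      = ‖wW t s‖ * ‖∏ i, gamG s (z i)‖ * (1 + ‖shX (s, z)‖) := by
        unfold kerC
        rw [norm_mul]
    _ ≤ (‖prefW‖ * Real.exp (T / 4 + 1 / 4) * Real.exp (-s ^ 2 / 4)) *
        ((1 + s ^ 2) ^ d * ∏ i, Real.exp (-z i ^ 2 / 4)) *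
        ((1 + s ^ 2) * ∏ i, Real.exp (2 + z i ^ 2 / 8)) := by
        gcongr
    _ = (‖prefW‖ * Real.exp (T / 4 + 1 / 4) * Real.exp (-s ^ 2 / 4)) * (1 + s ^ 2) ^ (d + 1) *
        (∏ i, Real.exp (-z i ^ 2 / 4) * Real.exp (2 + z i ^ 2 / 8)) := by
        rw [Finset.prod_mul_distrib]
        ring
    _ ≤ (‖prefW‖ * Real.exp (T / 4 + 1 / 4) * Real.exp (-s ^ 2 / 4)) *
        ((8 ^ (d + 1) * (d + 1).factorial * Real.exp (1 / 8)) * Real.exp (s ^ 2 / 8)) *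
        (∏ i, Real.exp (-z i ^ 2 / 4) * Real.exp (2 + z i ^ 2 / 8)) := by
        gcongr
    _ = _ := by
        have c1 : ∀ i, Real.exp (-z i ^ 2 / 4) * Real.exp (2 + z i ^ 2 / 8) =
            Real.exp 2 * Real.exp (-(1 / 8) * z i ^ 2) := by
          intro i
          rw [← Real.exp_add, ← Real.exp_add]
          ring_nf
        have c2 : Real.exp (-(1 / 8) * s ^ 2) = Real.exp (-s ^ 2 / 4) * Real.exp (s ^ 2 / 8) := by
          rw [← Real.exp_add]
          ring_nf
        simp_rw [c1]
        rw [Finset.prod_mul_distrib]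
        unfold domF
        simp only [c2]
        simp
        ring

lemma integrable_kerC {d : ℕ} (t : ℝ) : Integrable (kerC (d := d) t) := by
  obtain ⟨M, _, hM⟩ := kerC_bound d t
  refine ((integrable_domF d).const_mul M).mono' (continuous_kerC t).aestronglyMeasurable
    (Filter.Eventually.of_forall fun p => ?_)
  refine le_trans ?_ (hM t le_rfl p)
  nlinarith [norm_nonneg (kerC t p), norm_nonneg (shX p)]

lemma continuous_shX {d : ℕ} : Continuous (shX (d := d)) := by
  unfold shX
  have h1 : Continuous fun p : ℝ × (Fin d → ℝ) => Real.sqrt (1 + p.1 ^ 2) := by fun_prop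
  exact h1.smul ((PiLp.continuous_toLp 2 _).comp continuous_snd)

lemma integral_kerC {d : ℕ} {t : ℝ} (ht : 0 ≤ t) (k : Fin d → ℕ)
    (x : EuclideanSpace ℝ (Fin d)) :
    ∫ p : ℝ × (Fin d → ℝ), kerC t p * ((cosP k (x - t ^ (1 / 4 : ℝ) • shX p) : ℝ) : ℂ) =
      ((Real.exp (-(lam k ^ 2 + lam k) * t) * cosP k x : ℝ) : ℂ) := by
  have hint : Integrable fun p : ℝ × (Fin d → ℝ) =>
      kerC t p * ((cosP k (x - t ^ (1 / 4 : ℝ) • shX p) : ℝ) : ℂ) := by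
    refine (integrable_kerC t).mul_bdd (c := 1) ?_ (Filter.Eventually.of_forall fun p => ?_)
    · have h1 := continuous_shX (d := d)
      have h2 := continuous_cosP k
      apply Continuous.aestronglyMeasurable
      fun_prop
    · rw [Complex.norm_real, Real.norm_eq_abs]
      unfold cosP
      rw [Finset.abs_prod]
      exact Finset.prod_le_one (fun _ _ => abs_nonneg _) fun i _ => Real.abs_cos_le_one _
  have hvol : (volume : Measure (ℝ × (Fin d → ℝ))) = volume.prod volume := rfl
  rw [hvol] at hint ⊢
  rw [integral_prod _ hint]
  have inner : ∀ s : ℝ, ∫ z : Fin d → ℝ, kerC t (s, z) *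
      ((cosP k (x - t ^ (1 / 4 : ℝ) • shX (s, z)) : ℝ) : ℂ) =
      wW t s * Complex.exp (-(1 - s * Complex.I) * ((lam k : ℝ) * Real.sqrt t)) *
        ((cosP k x : ℝ) : ℂ) := by
    intro s
    set r : ℝ := t ^ (1 / 4 : ℝ) * Real.sqrt (1 + s ^ 2) with hr
    have e1 : ∀ z : Fin d → ℝ, kerC t (s, z) *
        ((cosP k (x - t ^ (1 / 4 : ℝ) • shX (s, z)) : ℝ) : ℂ) =
        wW t s * ∏ i, gamG s (z i) * ((Real.cos (k i * (x i - r * z i)) : ℝ) : ℂ) := by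
      intro z
      unfold kerC cosP shX
      rw [Finset.prod_mul_distrib, mul_assoc]
      congr 2
      push_cast
      refine Finset.prod_congr rfl fun i _ => ?_
      simp [hr, mul_assoc]
    simp_rw [e1]
    rw [integral_const_mul, integral_fintype_prod_volume_eq_prod (fun i (y : ℝ) =>
      gamG s y * ((Real.cos (k i * (x i - r * y)) : ℝ) : ℂ))]
    simp_rw [gauss1]
    rw [Finset.prod_mul_distrib, ← Complex.exp_sum, mul_assoc]
    unfold cosP
    push_cast
    congr 3
    have hr2 : (r : ℂ) ^ 2 = (Real.sqrt t : ℂ) * (1 + s ^ 2) := by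
      have : r ^ 2 = Real.sqrt t * (1 + s ^ 2) := by
        rw [hr, mul_pow, Real.sq_sqrt (by positivity), ← Real.rpow_natCast, ← Real.rpow_mul ht,
          Real.sqrt_eq_rpow]
        norm_num
      exact_mod_cast this
    have hne := one_add_ne s
    rw [hr2]
    unfold lam
    push_cast
    rw [Finset.sum_mul, Finset.mul_sum]
    refine Finset.sum_congr rfl fun i _ => ?_
    field_simp
    linear_combination (-(s : ℂ) ^ 2 * (k i) ^ 2 * (Real.sqrt t)) * Complex.I_sq
  simp_rw [inner]
  rw [integral_mul_const, integral_wW _ _ ht]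
  push_cast
  rfl

/-- The real kernel. -/
def kerR {d : ℕ} (t : ℝ) (p : ℝ × (Fin d → ℝ)) : ℝ := (kerC t p).re

lemma integrable_kerR {d : ℕ} (t : ℝ) : Integrable (kerR (d := d) t) := (integrable_kerC t).re

lemma integral_kerR {d : ℕ} {t : ℝ} (ht : 0 ≤ t) (k : Fin d → ℕ)
    (x : EuclideanSpace ℝ (Fin d)) :
    ∫ p : ℝ × (Fin d → ℝ), cosP k (x - t ^ (1 / 4 : ℝ) • shX p) * kerR t p =
      Real.exp (-(lam k ^ 2 + lam k) * t) * cosP k x := by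
  have h := integral_kerC ht k x
  have hint : Integrable fun p : ℝ × (Fin d → ℝ) =>
      kerC t p * ((cosP k (x - t ^ (1 / 4 : ℝ) • shX p) : ℝ) : ℂ) := by
    refine (integrable_kerC t).mul_bdd (c := 1) ?_ (Filter.Eventually.of_forall fun p => ?_)
    · have h1 := continuous_shX (d := d)
      have h2 := continuous_cosP k
      apply Continuous.aestronglyMeasurable
      fun_prop
    · rw [Complex.norm_real, Real.norm_eq_abs]
      unfold cosP
      rw [Finset.abs_prod]
      exact Finset.prod_le_one (fun _ _ => abs_nonneg _) fun i _ => Real.abs_cos_le_one _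
  have h2 := congrArg Complex.re h
  have h3 := integral_re hint
  simp only [RCLike.re_eq_complex_re] at h3
  rw [← h3, Complex.ofReal_re] at h2
  rw [← h2]
  congr 1
  ext p
  rw [Complex.re_mul_ofReal, mul_comm]
  rfl

lemma greenSemigroup_rep {d : ℕ} {t : ℝ} (ht : 0 < t) (f : C(boxK d, ℝ))
    (x : EuclideanSpace ℝ (Fin d)) :
    greenSemigroup (fun y => f (foldK y)) t x =
      ∫ p : ℝ × (Fin d → ℝ), f (foldK (x - t ^ (1 / 4 : ℝ) • shX p)) * kerR t p := by
  have hm : Measurable fun p : ℝ × (Fin d → ℝ) => foldK (x - t ^ (1 / 4 : ℝ) • shX p) := by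
    have h1 := continuous_shX (d := d)
    have h2 := continuous_foldK (d := d)
    apply Continuous.measurable
    fun_prop
  have h := clm_eq_of_cosK
    (kerCLM (volume.restrict (domD d)) (fun y => green x y t) (integrable_green ht x) foldK
      continuous_foldK.measurable)
    (kerCLM volume (kerR t) (integrable_kerR t) _ hm) ?_ f
  · rw [kerCLM_apply, kerCLM_apply] at h
    rw [← h]
    unfold greenSemigroup
    rw [if_neg ht.ne']
  · intro k
    rw [kerCLM_apply, kerCLM_apply]
    have e : ∀ y, cosK k (foldK y) = cosP k y := fun y => cosP_foldX k y
    simp_rw [e]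
    rw [integral_kerR ht.le, ← greenSemigroup_cosP ht]
    unfold greenSemigroup
    rw [if_neg ht.ne']

lemma continuousOn_of_holder {d : ℕ} {δ : ℝ} (hδ0 : 0 < δ) (H : ℝ)
    (u : EuclideanSpace ℝ (Fin d) → ℝ)
    (hu : ∀ x ∈ boxK d, ∀ y ∈ boxK d, |u x - u y| ≤ H * ‖x - y‖ ^ δ) :
    ContinuousOn u (boxK d) := by
  intro x hx
  have h0 : Filter.Tendsto (fun y => H * ‖y - x‖ ^ δ) (nhdsWithin x (boxK d)) (nhds 0) := by
    have hc : Continuous fun y : EuclideanSpace ℝ (Fin d) => H * ‖y - x‖ ^ δ :=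
      continuous_const.mul ((by fun_prop : Continuous fun y => ‖y - x‖).rpow_const
        fun _ => Or.inr hδ0.le)
    have := hc.tendsto x
    simp only [sub_self, norm_zero, Real.zero_rpow hδ0.ne', mul_zero] at this
    exact this.mono_left nhdsWithin_le_nhds
  refine tendsto_iff_dist_tendsto_zero.2 ?_
  refine squeeze_zero' (Filter.Eventually.of_forall fun _ => dist_nonneg) ?_ h0
  filter_upwards [self_mem_nhdsWithin] with y hy
  exact hu y hy x hx

lemma domD_subset (d : ℕ) : domD d ⊆ boxK d := by
  rw [← closure_domD]
  exact subset_closure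

lemma main_bounds (d : ℕ) (T : ℝ) {δ : ℝ} (hδ0 : 0 < δ) (hδ1 : δ < 1) :
    ∃ C : ℝ, 0 ≤ C ∧ ∀ (H : ℝ), 0 ≤ H → ∀ (u : EuclideanSpace ℝ (Fin d) → ℝ),
      (∀ x ∈ boxK d, ∀ y ∈ boxK d, |u x - u y| ≤ H * ‖x - y‖ ^ δ) →
      ∀ t, 0 < t → t ≤ T → ∀ x ∈ boxK d,
        (∀ y ∈ boxK d, |greenSemigroup u t x - greenSemigroup u t y| ≤ C * H * ‖x - y‖ ^ δ) ∧
        |greenSemigroup u t x - u x| ≤ C * H * t ^ (δ / 4) := by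
  obtain ⟨M, hM0, hM⟩ := kerC_bound d T
  refine ⟨M * ∫ p, domF (d := d) p, ?_, ?_⟩
  · refine mul_nonneg hM0 (integral_nonneg fun p => ?_)
    unfold domF
    positivity
  intro H hH u hu t ht htT
  have hcont := continuousOn_of_holder hδ0 H u hu
  let f : C(boxK d, ℝ) := ⟨fun x => u x.1, continuousOn_iff_continuous_domRestrict.1 hcont⟩
  set v : EuclideanSpace ℝ (Fin d) → ℝ := fun y => f (foldK y) with hv
  have hveq : ∀ x ∈ boxK d, v x = u x := by
    intro x hx
    change u (foldX x) = u x
    rw [foldX_eq hx]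
  have hvH : ∀ x y, |v x - v y| ≤ H * ‖x - y‖ ^ δ := by
    intro x y
    refine (hu _ (foldX_mem x) _ (foldX_mem y)).trans ?_
    have := foldX_lip x y
    gcongr
  have hvc : Continuous v := f.continuous.comp continuous_foldK
  have hS : ∀ x, greenSemigroup u t x =
      ∫ p : ℝ × (Fin d → ℝ), v (x - t ^ (1 / 4 : ℝ) • shX p) * kerR t p := by
    intro x
    rw [← greenSemigroup_rep ht f x]
    unfold greenSemigroup
    rw [if_neg ht.ne', if_neg ht.ne']
    refine setIntegral_congr_fun (measurableSet_domD d) fun y hy => ?_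
    have := hveq y (domD_subset d hy)
    simp only [hv] at this
    simp only [this]
  have hint : ∀ x, Integrable fun p : ℝ × (Fin d → ℝ) =>
      v (x - t ^ (1 / 4 : ℝ) • shX p) * kerR t p := by
    intro x
    refine (integrable_kerR t).bdd_mul (c := ‖f‖) ?_
      (Filter.Eventually.of_forall fun p => f.norm_coe_le_norm _)
    have h1 := continuous_shX (d := d)
    apply Continuous.aestronglyMeasurable
    fun_prop
  have hkb : ∀ p : ℝ × (Fin d → ℝ), |kerR t p| * (1 + ‖shX p‖) ≤ M * domF p := fun p =>
    (mul_le_mul_of_nonneg_right (Complex.abs_re_le_norm _) (by positivity)).trans (hM t htT p)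
  have hdom := (integrable_domF d).const_mul M
  have hone : ∫ p : ℝ × (Fin d → ℝ), kerR t p = 1 := by
    have := integral_kerR ht.le (0 : Fin d → ℕ) 0
    simpa [cosP, lam] using this
  intro x hx
  constructor
  · intro y hy
    rw [hS, hS, ← integral_sub (hint x) (hint y), ← Real.norm_eq_abs]
    refine (norm_integral_le_of_norm_le (hdom.const_mul (H * ‖x - y‖ ^ δ))
      (Filter.Eventually.of_forall fun p => ?_)).trans_eq ?_
    · rw [← sub_mul, norm_mul, Real.norm_eq_abs, Real.norm_eq_abs]
      have h1 := hvH (x - t ^ (1 / 4 : ℝ) • shX p) (y - t ^ (1 / 4 : ℝ) • shX p)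
      rw [sub_sub_sub_cancel_right] at h1
      refine mul_le_mul h1 ?_ (abs_nonneg _) (by positivity)
      refine le_trans ?_ (hkb p)
      nlinarith [abs_nonneg (kerR t p), norm_nonneg (shX p)]
    · rw [integral_const_mul, integral_const_mul]
      ring
  · have hux : u x = ∫ p : ℝ × (Fin d → ℝ), v x * kerR t p := by
      rw [integral_const_mul, hone, mul_one, hveq x hx]
    rw [hS, hux, ← integral_sub (hint x) ((integrable_kerR t).const_mul _), ← Real.norm_eq_abs]
    refine (norm_integral_le_of_norm_le (hdom.const_mul (H * t ^ (δ / 4)))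
      (Filter.Eventually.of_forall fun p => ?_)).trans_eq ?_
    · rw [← sub_mul, norm_mul, Real.norm_eq_abs, Real.norm_eq_abs]
      have h1 := hvH (x - t ^ (1 / 4 : ℝ) • shX p) x
      have h2 : ‖x - t ^ (1 / 4 : ℝ) • shX p - x‖ ^ δ ≤ t ^ (δ / 4) * (1 + ‖shX p‖) := by
        rw [sub_sub_cancel_left, norm_neg, norm_smul, Real.norm_of_nonneg (by positivity),
          Real.mul_rpow (by positivity) (norm_nonneg _), ← Real.rpow_mul ht.le]
        have e : 1 / 4 * δ = δ / 4 := by ring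
        rw [e]
        refine mul_le_mul_of_nonneg_left ?_ (by positivity)
        calc ‖shX p‖ ^ δ ≤ (1 + ‖shX p‖) ^ δ := by
              gcongr
              linarith
          _ ≤ (1 + ‖shX p‖) ^ (1 : ℝ) :=
              Real.rpow_le_rpow_of_exponent_le (by linarith [norm_nonneg (shX p)]) hδ1.le
          _ = _ := Real.rpow_one _
      calc _ ≤ (H * (t ^ (δ / 4) * (1 + ‖shX p‖))) * |kerR t p| :=
            mul_le_mul_of_nonneg_right (h1.trans (mul_le_mul_of_nonneg_left h2 hH)) (abs_nonneg _)
        _ = H * t ^ (δ / 4) * (|kerR t p| * (1 + ‖shX p‖)) := by ring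
        _ ≤ _ := mul_le_mul_of_nonneg_left (hkb p) (by positivity)
    · rw [integral_const_mul, integral_const_mul]
      ring

/-- If `u₀` is `δ`-Hölder continuous on the closure of `D` (`0 < δ < 1`), then for every
`T > 0` there is `C > 0` such that `(x,t) ↦ G_t u₀(x)` is `δ`-Hölder continuous in space
and `δ/4`-Hölder continuous in time on `closure(D) × [0,T]`. -/
theorem statement18 (d : ℕ) (hd : d = 1 ∨ d = 2 ∨ d = 3)
    (δ : ℝ) (hδ0 : 0 < δ) (hδ1 : δ < 1)
    (u₀ : EuclideanSpace ℝ (Fin d) → ℝ) (H : ℝ)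
    (hu₀ : ∀ x ∈ closure (domD d), ∀ y ∈ closure (domD d),
      |u₀ x - u₀ y| ≤ H * ‖x - y‖ ^ δ) :
    ∀ T : ℝ, 0 < T → ∃ C > (0 : ℝ),
      ∀ x ∈ closure (domD d), ∀ y ∈ closure (domD d),
        ∀ s ∈ Set.Icc (0 : ℝ) T, ∀ t ∈ Set.Icc (0 : ℝ) T,
          |greenSemigroup u₀ t x - greenSemigroup u₀ t y| ≤ C * ‖x - y‖ ^ δ ∧
          |greenSemigroup u₀ t x - greenSemigroup u₀ s x| ≤ C * |t - s| ^ (δ / 4) := by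

  intro T _
  rw [closure_domD] at hu₀ ⊢
  obtain ⟨C, hC0, hC⟩ := main_bounds d T hδ0 hδ1
  have hH0 : 0 ≤ |H| := abs_nonneg H
  have hu : ∀ x ∈ boxK d, ∀ y ∈ boxK d, |u₀ x - u₀ y| ≤ |H| * ‖x - y‖ ^ δ := fun x hx y hy =>
    (hu₀ x hx y hy).trans (mul_le_mul_of_nonneg_right (le_abs_self H) (by positivity))
  have hint : Integrable u₀ (volume.restrict (domD d)) :=
    ((continuousOn_of_holder hδ0 _ u₀ hu).integrableOn_compact (μ := volume)
      (isCompact_boxK d)).mono_set (domD_subset d)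
  have hs0 : ∀ x, greenSemigroup u₀ 0 x = u₀ x := fun x => by simp [greenSemigroup]
  set C' := |H| + C * |H| + C * (C * |H|) + 1 with hC'
  have q1 : 0 ≤ C * |H| := by positivity
  have q2 : 0 ≤ C * (C * |H|) := by positivity
  have time : ∀ x ∈ boxK d, ∀ s t : ℝ, 0 ≤ s → s < t → t ≤ T →
      |greenSemigroup u₀ t x - greenSemigroup u₀ s x| ≤ C' * (t - s) ^ (δ / 4) := by
    intro x hx s t hs hst htT
    have hp : 0 ≤ (t - s) ^ (δ / 4) := Real.rpow_nonneg (by linarith) _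
    rcases hs.eq_or_lt with rfl | hs
    · rw [hs0]
      have := (hC |H| hH0 u₀ hu t hst htT x hx).2
      rw [sub_zero] at hp ⊢
      exact this.trans (mul_le_mul_of_nonneg_right (by linarith) hp)
    · have h1 := fun x hx => (hC |H| hH0 u₀ hu s hs (by linarith) x hx).1
      have h2 := (hC (C * |H|) q1 (greenSemigroup u₀ s) h1 (t - s) (by linarith)
        (by linarith) x hx).2
      rw [greenSemigroup_add hs (by linarith) u₀ hint, sub_add_cancel] at h2
      exact h2.trans (mul_le_mul_of_nonneg_right (by linarith) hp)
  refine ⟨C', by linarith, fun x hx y hy s hs t ht => ⟨?_, ?_⟩⟩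
  · have hp : 0 ≤ ‖x - y‖ ^ δ := by positivity
    rcases ht.1.eq_or_lt with h | h
    · rw [← h, hs0, hs0]
      exact (hu x hx y hy).trans (mul_le_mul_of_nonneg_right (by linarith) hp)
    · exact ((hC |H| hH0 u₀ hu t h ht.2 x hx).1 y hy).trans
        (mul_le_mul_of_nonneg_right (by linarith) hp)
  · rcases lt_trichotomy s t with h | h | h
    · rw [abs_of_pos (sub_pos.2 h)]
      exact time x hx s t hs.1 h ht.2
    · rw [h, sub_self, abs_zero]
      positivity
    · rw [abs_sub_comm, abs_sub_comm t s, abs_of_pos (sub_pos.2 h)]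
      exact time x hx t s ht.1 h hs.2
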